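/- Let ρ_AB be a density operator on H_A ⊗ H_B and let α, β, γ ≠ 1 satisfy α/(α−1) = β/(β−1) + γ/(γ−1). If α ∈ (0,1), γ ∈ [1/2,1) and β ∈ (1,∞), then I↑_γ(A;B)_ρ ≥ H_β(B)_ρ − H↓_α(B|A)_ρ and I↓_γ(A:B)_ρ ≥ H_β(B)_ρ − H↑_α(B|A)_ρ. If β ∈ [1/2,1), γ ∈ (1,2) and α ∈ (1,∞), then I↑_γ(A;B)_ρ ≤ H_β(B)_ρ − H↓_α(B|A)_ρ and I↓_γ(A:B)_ρ ≤ H_β(B)_ρ − H↑_α(B|A)_ρ. -/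

import Mathlib

open scoped Kronecker ComplexOrder Classical
open Matrix

noncomputable section

/-- Real power taken on the support: `0 ^ r = 0` for every `r`. -/
def supPow (x r : ℝ) : ℝ := if x = 0 then 0 else x ^ r

variable {n : Type*} [Fintype n] [DecidableEq n]

/-- Power of a Hermitian matrix, taken on its support (junk value `0` otherwise). -/
def matPow (M : Matrix n n ℂ) (r : ℝ) : Matrix n n ℂ :=
  if hM : M.IsHermitian then
    (hM.eigenvectorUnitary : Matrix n n ℂ) *
      (Matrix.diagonal fun i => (supPow (hM.eigenvalues i) r : ℂ)) *
      (star (hM.eigenvectorUnitary : Matrix n n ℂ))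
  else 0

/-- A density operator: positive semidefinite with unit trace. -/
def IsDensity (ρ : Matrix n n ℂ) : Prop := ρ.PosSemidef ∧ ρ.trace = 1

/-- `σ` dominates `ρ`: the kernel of `σ` is contained in the kernel of `ρ`
(equivalently, `supp ρ ⊆ supp σ` for positive semidefinite matrices). -/
def Dominates (σ ρ : Matrix n n ℂ) : Prop := ∀ v, σ.mulVec v = 0 → ρ.mulVec v = 0

/-- The sandwiched Rényi divergence of order `α` (base-2 logarithm), with value `⊤`
when `ρ ⟂ σ`, or when `α > 1` and `supp ρ ⊄ supp σ`. -/
def renyiDiv (α : ℝ) (ρ σ : Matrix n n ℂ) : EReal :=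
  if (ρ * σ).trace ≠ 0 ∧ (Dominates σ ρ ∨ α < 1) then
    (((α - 1)⁻¹ * Real.logb 2
      ((matPow (matPow σ ((1 - α) / (2 * α)) * ρ * matPow σ ((1 - α) / (2 * α))) α).trace.re) : ℝ)
      : EReal)
  else ⊤

/-- The Rényi entropy of order `α` (base-2 logarithm). -/
def renyiEntropy (α : ℝ) (ρ : Matrix n n ℂ) : ℝ :=
  (1 - α)⁻¹ * Real.logb 2 ((matPow ρ α).trace.re)

variable {A B : Type*} [Fintype A] [Fintype B] [DecidableEq A] [DecidableEq B]

/-- Marginal on the first factor: `ρ_A = tr_B ρ_AB`. -/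
def margFst (ρ : Matrix (A × B) (A × B) ℂ) : Matrix A A ℂ :=
  Matrix.of fun a a' => ∑ b, ρ (a, b) (a', b)

/-- Marginal on the second factor: `ρ_B = tr_A ρ_AB`. -/
def margSnd (ρ : Matrix (A × B) (A × B) ℂ) : Matrix B B ℂ :=
  Matrix.of fun b b' => ∑ a, ρ (a, b) (a, b')

/-- `H↓_α(B|A)_ρ = −D_α(ρ_AB ‖ ρ_A ⊗ 1_B)`. -/
def condEntDown (α : ℝ) (ρ : Matrix (A × B) (A × B) ℂ) : EReal :=
  - renyiDiv α ρ (margFst ρ ⊗ₖ (1 : Matrix B B ℂ))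

/-- `H↑_α(B|A)_ρ = sup_{σ_A} −D_α(ρ_AB ‖ σ_A ⊗ 1_B)`. -/
def condEntUp (α : ℝ) (ρ : Matrix (A × B) (A × B) ℂ) : EReal :=
  ⨆ σA : {σ : Matrix A A ℂ // IsDensity σ},
    - renyiDiv α ρ ((σA : Matrix A A ℂ) ⊗ₖ (1 : Matrix B B ℂ))

/-- `I↑_γ(A;B)_ρ = inf_{σ_B} D_γ(ρ_AB ‖ ρ_A ⊗ σ_B)`. -/
def mutInfUp (γ : ℝ) (ρ : Matrix (A × B) (A × B) ℂ) : EReal :=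
  ⨅ σB : {σ : Matrix B B ℂ // IsDensity σ},
    renyiDiv γ ρ (margFst ρ ⊗ₖ (σB : Matrix B B ℂ))

/-- `I↓_γ(A:B)_ρ = inf_{σ_A, σ_B} D_γ(ρ_AB ‖ σ_A ⊗ σ_B)`. -/
def mutInfDown (γ : ℝ) (ρ : Matrix (A × B) (A × B) ℂ) : EReal :=
  ⨅ σA : {σ : Matrix A A ℂ // IsDensity σ}, ⨅ σB : {σ : Matrix B B ℂ // IsDensity σ},
    renyiDiv γ ρ ((σA : Matrix A A ℂ) ⊗ₖ (σB : Matrix B B ℂ))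

end

section Scalar

theorem supPow_nonneg {x : ℝ} (hx : 0 ≤ x) (r : ℝ) : 0 ≤ supPow x r := by
  unfold supPow
  split_ifs
  exacts [le_rfl, Real.rpow_nonneg hx r]

theorem supPow_pos {x : ℝ} (hx : 0 < x) (r : ℝ) : 0 < supPow x r := by
  rw [supPow, if_neg hx.ne']
  exact Real.rpow_pos_of_pos hx r

theorem supPow_eq_rpow {r : ℝ} (x : ℝ) (hr : r ≠ 0) : supPow x r = x ^ r := by
  unfold supPow
  split_ifs with h
  · rw [h, Real.zero_rpow hr]
  · rfl

theorem supPow_mul {x y : ℝ} (hx : 0 ≤ x) (hy : 0 ≤ y) (r : ℝ) :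
    supPow (x * y) r = supPow x r * supPow y r := by
  by_cases h : x = 0
  · simp [supPow, h]
  by_cases h' : y = 0
  · simp [supPow, h']
  simp [supPow, h, h', Real.mul_rpow hx hy]

theorem supPow_rpow {x : ℝ} (hx : 0 ≤ x) (r : ℝ) {q : ℝ} (hq : q ≠ 0) :
    (supPow x r) ^ q = supPow x (r * q) := by
  by_cases h : x = 0
  · simp [supPow, h, Real.zero_rpow hq]
  simp [supPow, h, Real.rpow_mul hx]

theorem supPow_mul_self {x : ℝ} (hx : 0 ≤ x) (r : ℝ) :
    supPow x r * supPow x r = supPow x (2 * r) := by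
  by_cases h : x = 0
  · simp [supPow, h]
  have hx' : 0 < x := lt_of_le_of_ne hx (Ne.symm h)
  simp [supPow, h, ← Real.rpow_add hx', two_mul]

/-- Hölder's inequality for weights summing to one. -/
theorem sum_rpow_mul_rpow_le {ι : Type*} (s : Finset ι) {f g : ι → ℝ} (hf : ∀ i, 0 ≤ f i)
    (hg : ∀ i, 0 ≤ g i) {θ φ : ℝ} (hθ : 0 < θ) (hφ : 0 < φ) (h : θ + φ = 1) :
    ∑ i ∈ s, f i ^ θ * g i ^ φ ≤ (∑ i ∈ s, f i) ^ θ * (∑ i ∈ s, g i) ^ φ := by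
  have hpq : Real.HolderConjugate θ⁻¹ φ⁻¹ := by
    rw [Real.holderConjugate_iff]
    exact ⟨(one_lt_inv₀ hθ).2 (by linarith), by simpa using h⟩
  have := Real.inner_le_Lp_mul_Lq_of_nonneg s hpq (f := fun i => f i ^ θ) (g := fun i => g i ^ φ)
    (fun i _ => Real.rpow_nonneg (hf i) _) (fun i _ => Real.rpow_nonneg (hg i) _)
  simpa [← Real.rpow_mul (hf _), ← Real.rpow_mul (hg _), hθ.ne', hφ.ne'] using this

variable {A B : Type*} [Fintype A] [Fintype B]

theorem sum_supPow_mul_le {t : A → ℝ} {s : B → ℝ} {p : A × B → ℝ} (ht : ∀ i, 0 ≤ t i)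
    (hs : ∀ j, 0 ≤ s j) (hp : ∀ x, 0 ≤ p x) {a b : ℝ} (ha : 0 < a) (hb : 0 < b) (η : ℝ) :
    ∑ x, supPow (t x.1 * s x.2) (η / (a + b)) * p x ≤
      (∑ x, supPow (s x.2) (η / b) * p x) ^ (b / (a + b)) *
        (∑ x, supPow (t x.1) (η / a) * p x) ^ (a / (a + b)) := by
  have hab : 0 < a + b := by positivity
  have hθ : 0 < b / (a + b) := div_pos hb hab
  have hφ : 0 < a / (a + b) := div_pos ha hab
  have hθφ : b / (a + b) + a / (a + b) = 1 := by rw [← add_div, add_comm b a, div_self hab.ne']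
  have e1 : η / b * (b / (a + b)) = η / (a + b) := div_mul_div_cancel₀ hb.ne'
  have e2 : η / a * (a / (a + b)) = η / (a + b) := div_mul_div_cancel₀ ha.ne'
  generalize b / (a + b) = θ at *
  generalize a / (a + b) = φ at *
  have key := sum_rpow_mul_rpow_le Finset.univ
    (f := fun x : A × B => supPow (s x.2) (η / b) * p x)
    (g := fun x : A × B => supPow (t x.1) (η / a) * p x)
    (fun x => mul_nonneg (supPow_nonneg (hs x.2) _) (hp x))
    (fun x => mul_nonneg (supPow_nonneg (ht x.1) _) (hp x)) hθ hφ hθφ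
  refine le_trans (le_of_eq (Finset.sum_congr rfl fun x _ => ?_)) key
  have e3 : p x ^ θ * p x ^ φ = p x := by
    rw [← Real.rpow_add_of_nonneg (hp x) hθ.le hφ.le, hθφ, Real.rpow_one]
  rw [Real.mul_rpow (supPow_nonneg (hs _) _) (hp x), Real.mul_rpow (supPow_nonneg (ht _) _) (hp x),
    supPow_rpow (hs _) _ hθ.ne', supPow_rpow (ht _) _ hφ.ne', supPow_mul (ht _) (hs _), e1, e2,
    mul_mul_mul_comm, e3]
  ring

/-- The commutative core of the decomposition rules: two applications of Hölder's inequality. -/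
theorem sum_rpow_sum_supPow_le {K : Type*} [Fintype K] {t : A → ℝ} {s : B → ℝ}
    {p : K → A × B → ℝ} (ht : ∀ i, 0 ≤ t i)
    (hs : ∀ j, 0 ≤ s j) (hp : ∀ k x, 0 ≤ p k x) {a b η : ℝ} (ha : 0 < a) (hb : 0 < b)
    (haη : 0 < a + η) :
    ∑ k, (∑ x, supPow (t x.1 * s x.2) (η / (a + b)) * p k x) ^ ((a + b) / (a + b + η)) ≤
      (∑ j, supPow (s j) (η / b) * ∑ i, ∑ k, p k (i, j)) ^ (b / (a + b + η)) *
        (∑ k, (∑ x, supPow (t x.1) (η / a) * p k x) ^ (a / (a + η))) ^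
          ((a + η) / (a + b + η)) := by
  have hab : 0 < a + b := by positivity
  have hg : 0 < a + b + η := by linarith
  set W : K → ℝ := fun k => ∑ x, supPow (s x.2) (η / b) * p k x
  set Z : K → ℝ := fun k => ∑ x, supPow (t x.1) (η / a) * p k x
  have hW : ∀ k, 0 ≤ W k := fun k =>
    Finset.sum_nonneg fun x _ => mul_nonneg (supPow_nonneg (hs _) _) (hp k x)
  have hZ : ∀ k, 0 ≤ Z k := fun k =>
    Finset.sum_nonneg fun x _ => mul_nonneg (supPow_nonneg (ht _) _) (hp k x)
  have hWsum : ∑ j, supPow (s j) (η / b) * ∑ i, ∑ k, p k (i, j) = ∑ k, W k := by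
    simp only [W, Fintype.sum_prod_type_right, Finset.mul_sum]
    rw [Finset.sum_comm' (t' := Finset.univ) (s' := fun _ => Finset.univ) (by simp)]
    conv_rhs => rw [Finset.sum_comm]
    rw [Finset.sum_comm]
    refine Finset.sum_congr rfl fun j _ => ?_
    rw [Finset.sum_comm]
  rw [hWsum]
  refine le_trans (Finset.sum_le_sum fun k _ => ?_) (sum_rpow_mul_rpow_le Finset.univ hW
    (fun k => Real.rpow_nonneg (hZ k) (a / (a + η))) (div_pos hb hg) (div_pos haη hg)
    (by field_simp; ring))
  have h1 := Real.rpow_le_rpow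
    (Finset.sum_nonneg fun x _ => mul_nonneg (supPow_nonneg (mul_nonneg (ht _) (hs _)) _) (hp k x))
    (sum_supPow_mul_le ht hs (hp k) ha hb η) (div_pos hab hg).le
  refine h1.trans (le_of_eq ?_)
  rw [Real.mul_rpow (Real.rpow_nonneg (hW k) _) (Real.rpow_nonneg (hZ k) _),
    ← Real.rpow_mul (hW k), ← Real.rpow_mul (hZ k), ← Real.rpow_mul (hZ k)]
  congr 2 <;> field_simp

end Scalar

section Spectral

variable {m n : Type*} [Fintype n] [DecidableEq n]

theorem Matrix.IsHermitian.eq_conj_diagonal {M : Matrix n n ℂ} (hM : M.IsHermitian) :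
    M = (hM.eigenvectorUnitary : Matrix n n ℂ) *
      diagonal (fun i => (hM.eigenvalues i : ℂ)) * (hM.eigenvectorUnitary : Matrix n n ℂ)ᴴ := by
  conv_lhs => rw [hM.spectral_theorem]
  rw [Unitary.conjStarAlgAut_apply]
  rfl

theorem Matrix.unitary_mul_conjTranspose {U : Matrix n n ℂ} (hU : U ∈ unitaryGroup n ℂ) :
    U * Uᴴ = 1 := mem_unitaryGroup_iff.1 hU

theorem Matrix.unitary_conjTranspose_mul {U : Matrix n n ℂ} (hU : U ∈ unitaryGroup n ℂ) :
    Uᴴ * U = 1 := mem_unitaryGroup_iff'.1 hU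

theorem conj_diagonal_isHermitian (W : Matrix m n ℂ) (d : n → ℝ) :
    (W * diagonal (fun i => (d i : ℂ)) * Wᴴ).IsHermitian := by
  simp only [IsHermitian, conjTranspose_mul, conjTranspose_conjTranspose, Matrix.mul_assoc,
    diagonal_conjTranspose]
  congr 3
  ext i
  simp

theorem matPow_eq_conj_diagonal {M W : Matrix n n ℂ} (hW : W ∈ unitaryGroup n ℂ) {d : n → ℝ}
    (h : M = W * diagonal (fun i => (d i : ℂ)) * Wᴴ) (r : ℝ) :
    matPow M r = W * diagonal (fun i => (supPow (d i) r : ℂ)) * Wᴴ := by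
  have hM : M.IsHermitian := h ▸ conj_diagonal_isHermitian W d
  have hWW := unitary_mul_conjTranspose hW
  have hWW' := unitary_conjTranspose_mul hW
  rw [matPow, dif_pos hM]
  set U : Matrix n n ℂ := (hM.eigenvectorUnitary : Matrix n n ℂ)
  have hUU : U * Uᴴ = 1 := unitary_mul_conjTranspose hM.eigenvectorUnitary.2
  have hUU' : Uᴴ * U = 1 := unitary_conjTranspose_mul hM.eigenvectorUnitary.2
  have hspec : M = U * diagonal (fun i => (hM.eigenvalues i : ℂ)) * Uᴴ := hM.eq_conj_diagonal
  have h1 : diagonal (fun i => (d i : ℂ)) * (Wᴴ * U) =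
      Wᴴ * U * diagonal (fun i => (hM.eigenvalues i : ℂ)) := by
    calc _ = (Wᴴ * W) * diagonal (fun i => (d i : ℂ)) * (Wᴴ * U) := by rw [hWW', Matrix.one_mul]
      _ = Wᴴ * M * U := by rw [h]; simp only [Matrix.mul_assoc]
      _ = Wᴴ * (U * diagonal (fun i => (hM.eigenvalues i : ℂ)) * Uᴴ) * U := by rw [← hspec]
      _ = Wᴴ * U * diagonal (fun i => (hM.eigenvalues i : ℂ)) * (Uᴴ * U) := by
        simp only [Matrix.mul_assoc]
      _ = _ := by rw [hUU', Matrix.mul_one]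
  have h2 : diagonal (fun i => (supPow (d i) r : ℂ)) * (Wᴴ * U) =
      Wᴴ * U * diagonal (fun i => (supPow (hM.eigenvalues i) r : ℂ)) := by
    ext i j
    have hij := congrFun (congrFun h1 i) j
    rw [diagonal_mul, mul_diagonal] at hij ⊢
    by_cases hc : (Wᴴ * U) i j = 0
    · simp [hc]
    · rw [mul_comm] at hij
      have := Complex.ofReal_injective (mul_left_cancel₀ hc hij)
      rw [this, mul_comm]
  change U * _ * Uᴴ = _
  calc U * diagonal (fun i => (supPow (hM.eigenvalues i) r : ℂ)) * Uᴴ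
      = W * (Wᴴ * U * diagonal (fun i => (supPow (hM.eigenvalues i) r : ℂ))) * Uᴴ := by
        simp only [← Matrix.mul_assoc, hWW, Matrix.one_mul]
    _ = W * diagonal (fun i => (supPow (d i) r : ℂ)) * Wᴴ * (U * Uᴴ) := by
        rw [← h2]; simp only [Matrix.mul_assoc]
    _ = _ := by rw [hUU, Matrix.mul_one]

theorem trace_matPow {M : Matrix n n ℂ} (hM : M.IsHermitian) (r : ℝ) :
    (matPow M r).trace.re = ∑ i, supPow (hM.eigenvalues i) r := by
  rw [matPow, dif_pos hM, Matrix.trace_mul_comm, ← Matrix.mul_assoc, Unitary.coe_star_mul_self,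
    Matrix.one_mul, trace_diagonal]
  simp

theorem trace_matPow_eq_of_charpoly_eq {M N : Matrix n n ℂ} (hM : M.IsHermitian)
    (hN : N.IsHermitian) (h : M.charpoly = N.charpoly) (r : ℝ) :
    (matPow M r).trace.re = (matPow N r).trace.re := by
  rw [trace_matPow hM, trace_matPow hN]
  have h' := hM.roots_charpoly_eq_eigenvalues
  rw [h, hN.roots_charpoly_eq_eigenvalues] at h'
  have := congrArg (fun s : Multiset ℂ => (s.map fun z => supPow z.re r).sum) h'
  simpa [Multiset.map_map, Function.comp_def] using this.symm

/-- The diagonal of `C D Cᴴ` for a real diagonal matrix `D`. -/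
theorem conj_diagonal_apply_self_re (C : Matrix m n ℂ) (d : n → ℝ) (k : m) :
    ((C * diagonal (fun i => (d i : ℂ)) * Cᴴ) k k).re = ∑ l, d l * Complex.normSq (C k l) := by
  rw [Matrix.mul_apply, Complex.re_sum]
  refine Finset.sum_congr rfl fun l _ => ?_
  rw [mul_diagonal, conjTranspose_apply]
  simp [Complex.normSq_apply]
  ring

theorem mul_conjTranspose_apply_self_re (C : Matrix m n ℂ) (k : m) :
    ((C * Cᴴ) k k).re = ∑ l, Complex.normSq (C k l) := by
  have := conj_diagonal_apply_self_re C (fun _ => 1) k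
  simpa using this

theorem conjTranspose_mul_apply_self_re (C : Matrix n m ℂ) (k : m) :
    ((Cᴴ * C) k k).re = ∑ l, Complex.normSq (C l k) := by
  have := mul_conjTranspose_apply_self_re Cᴴ k
  simpa using this

/-- The diagonal of a Hermitian matrix in any orthonormal basis is obtained from its eigenvalues by
a doubly stochastic matrix. -/
theorem exists_doublyStochastic_eigenvalues {M : Matrix n n ℂ} (hM : M.IsHermitian)
    {E : Matrix n n ℂ} (hE : E ∈ unitaryGroup n ℂ) :
    ∃ w : n → n → ℝ, (∀ k l, 0 ≤ w k l) ∧ (∀ k, ∑ l, w k l = 1) ∧ (∀ l, ∑ k, w k l = 1) ∧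
      ∀ k, ((Eᴴ * M * E) k k).re = ∑ l, w k l * hM.eigenvalues l := by
  have hUU := unitary_mul_conjTranspose hM.eigenvectorUnitary.2
  have hUU' := unitary_conjTranspose_mul hM.eigenvectorUnitary.2
  have hEE := unitary_mul_conjTranspose hE
  have hEE' := unitary_conjTranspose_mul hE
  set U : Matrix n n ℂ := (hM.eigenvectorUnitary : Matrix n n ℂ)
  refine ⟨fun k l => Complex.normSq ((Eᴴ * U) k l), fun _ _ => Complex.normSq_nonneg _,
    fun k => ?_, fun l => ?_, fun k => ?_⟩
  · have : (Eᴴ * U) * (Eᴴ * U)ᴴ = 1 := by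
      rw [conjTranspose_mul, conjTranspose_conjTranspose,
        Matrix.mul_assoc, ← Matrix.mul_assoc U, hUU, Matrix.one_mul, hEE']
    rw [← mul_conjTranspose_apply_self_re, this]
    simp
  · have : (Eᴴ * U)ᴴ * (Eᴴ * U) = 1 := by
      rw [conjTranspose_mul, conjTranspose_conjTranspose,
        Matrix.mul_assoc, ← Matrix.mul_assoc E, hEE, Matrix.one_mul, hUU']
    rw [← conjTranspose_mul_apply_self_re, this]
    simp
  · have : Eᴴ * M * E = (Eᴴ * U) * diagonal (fun i => (hM.eigenvalues i : ℂ)) * (Eᴴ * U)ᴴ := by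
      conv_lhs => rw [hM.eq_conj_diagonal]
      rw [conjTranspose_mul, conjTranspose_conjTranspose]
      simp only [Matrix.mul_assoc, U]
    rw [this, conj_diagonal_apply_self_re]
    exact Finset.sum_congr rfl fun l _ => mul_comm _ _

/-- Peierls' inequality for a convex power. -/
theorem sum_diag_rpow_le_trace_matPow {M : Matrix n n ℂ} (hM : M.PosSemidef) {E : Matrix n n ℂ}
    (hE : E ∈ unitaryGroup n ℂ) {r : ℝ} (hr : 1 ≤ r) :
    ∑ k, ((Eᴴ * M * E) k k).re ^ r ≤ (matPow M r).trace.re := by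
  obtain ⟨w, hw, hrow, hcol, hd⟩ := exists_doublyStochastic_eigenvalues hM.1 hE
  rw [trace_matPow hM.1]
  calc ∑ k, ((Eᴴ * M * E) k k).re ^ r ≤ ∑ k, ∑ l, w k l * hM.1.eigenvalues l ^ r := by
        refine Finset.sum_le_sum fun k _ => ?_
        rw [hd]
        exact Real.rpow_arith_mean_le_arith_mean_rpow _ _ _ (fun l _ => hw k l) (hrow k)
          (fun l _ => hM.eigenvalues_nonneg l) hr
    _ = ∑ l, supPow (hM.1.eigenvalues l) r := by
        rw [Finset.sum_comm]
        refine Finset.sum_congr rfl fun l _ => ?_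
        rw [← Finset.sum_mul, hcol, one_mul, supPow_eq_rpow _ (by linarith)]

/-- Peierls' inequality for a concave power. -/
theorem trace_matPow_le_sum_diag_rpow {M : Matrix n n ℂ} (hM : M.PosSemidef) {E : Matrix n n ℂ}
    (hE : E ∈ unitaryGroup n ℂ) {r : ℝ} (hr : 0 < r) (hr1 : r ≤ 1) :
    (matPow M r).trace.re ≤ ∑ k, ((Eᴴ * M * E) k k).re ^ r := by
  obtain ⟨w, hw, hrow, hcol, hd⟩ := exists_doublyStochastic_eigenvalues hM.1 hE
  rw [trace_matPow hM.1]
  calc ∑ l, supPow (hM.1.eigenvalues l) r = ∑ k, ∑ l, w k l * hM.1.eigenvalues l ^ r := by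
        rw [Finset.sum_comm]
        refine Finset.sum_congr rfl fun l _ => ?_
        rw [← Finset.sum_mul, hcol, one_mul, supPow_eq_rpow _ hr.ne']
    _ ≤ ∑ k, ((Eᴴ * M * E) k k).re ^ r := by
        refine Finset.sum_le_sum fun k _ => ?_
        rw [hd]
        simpa using (Real.concaveOn_rpow hr.le hr1).le_map_sum (t := Finset.univ)
          (fun l _ => hw k l) (hrow k) (fun l _ => hM.eigenvalues_nonneg l)

theorem sum_diag_eigenvectorUnitary {M : Matrix n n ℂ} (hM : M.IsHermitian) {r : ℝ} (hr : r ≠ 0) :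
    ∑ k, (((hM.eigenvectorUnitary : Matrix n n ℂ)ᴴ * M * hM.eigenvectorUnitary) k k).re ^ r =
      (matPow M r).trace.re := by
  have hUU' := unitary_conjTranspose_mul hM.eigenvectorUnitary.2
  rw [trace_matPow hM]
  refine Finset.sum_congr rfl fun k _ => ?_
  set U : Matrix n n ℂ := (hM.eigenvectorUnitary : Matrix n n ℂ)
  have : Uᴴ * M * U = diagonal (fun i => (hM.eigenvalues i : ℂ)) := by
    conv_lhs => rw [hM.eq_conj_diagonal]
    change Uᴴ * (U * _ * Uᴴ) * U = _
    calc _ = (Uᴴ * U) * diagonal (fun i => (hM.eigenvalues i : ℂ)) * (Uᴴ * U) := by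
          simp only [Matrix.mul_assoc]
      _ = _ := by rw [hUU', Matrix.one_mul, Matrix.mul_one]
  rw [this, supPow_eq_rpow _ hr]
  simp

theorem trace_matPow_pos {M : Matrix n n ℂ} (hM : M.PosSemidef) (h : M.trace ≠ 0) (r : ℝ) :
    0 < (matPow M r).trace.re := by
  rw [trace_matPow hM.1]
  obtain ⟨i, hi⟩ : ∃ i, hM.1.eigenvalues i ≠ 0 := by
    by_contra! hc
    exact h (by rw [hM.1.trace_eq_sum_eigenvalues]; simp [hc])
  exact Finset.sum_pos' (fun i _ => supPow_nonneg (hM.eigenvalues_nonneg i) r)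
    ⟨i, Finset.mem_univ i, supPow_pos (lt_of_le_of_ne (hM.eigenvalues_nonneg i) hi.symm) r⟩

end Spectral

section Sandwich

variable {m n : Type*} [Fintype m] [Fintype n] [DecidableEq n]

theorem conj_diagonal_posSemidef (C : Matrix m n ℂ) {e : n → ℝ} (he : ∀ x, 0 ≤ e x) :
    (C * diagonal (fun x => (e x : ℂ)) * Cᴴ).PosSemidef :=
  (PosSemidef.diagonal fun x => by simpa using he x).mul_mul_conjTranspose_same C

theorem trace_conj_diagonal (C : Matrix m n ℂ) (e : n → ℝ) :
    (C * diagonal (fun x => (e x : ℂ)) * Cᴴ).trace =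
      ((∑ x, e x * ∑ k, Complex.normSq (C k x) : ℝ) : ℂ) := by
  rw [Matrix.trace_mul_comm, ← Matrix.mul_assoc, Matrix.trace]
  push_cast
  refine Finset.sum_congr rfl fun x _ => ?_
  rw [diag_apply, mul_diagonal, mul_comm, Matrix.mul_apply]
  congr 1
  refine Finset.sum_congr rfl fun k _ => ?_
  rw [conjTranspose_apply, Complex.normSq_eq_conj_mul_self]
  rfl

theorem trace_conj_diagonal_ne_zero_iff (C : Matrix m n ℂ) {e : n → ℝ} (he : ∀ x, 0 ≤ e x) :
    (C * diagonal (fun x => (e x : ℂ)) * Cᴴ).trace ≠ 0 ↔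
      ∃ x, e x ≠ 0 ∧ ∑ k, Complex.normSq (C k x) ≠ 0 := by
  rw [trace_conj_diagonal, Complex.ofReal_ne_zero, Ne, Finset.sum_eq_zero_iff_of_nonneg
    fun x _ => mul_nonneg (he x) (Finset.sum_nonneg fun k _ => Complex.normSq_nonneg _)]
  simp

theorem supPow_ne_zero_iff {x : ℝ} (hx : 0 ≤ x) (r : ℝ) : supPow x r ≠ 0 ↔ x ≠ 0 := by
  refine ⟨fun h h0 => h (by simp [supPow, h0]), fun h => ?_⟩
  exact (supPow_pos (lt_of_le_of_ne hx h.symm) r).ne'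

/-- The sandwiched operator has the same spectrum as its version compressed to the purifying
space. -/
theorem trace_matPow_sandwich {D W : Matrix n n ℂ} (hW : W ∈ unitaryGroup n ℂ) {d : n → ℝ}
    (hd : ∀ x, 0 ≤ d x) (hD : D = W * diagonal (fun x => (d x : ℂ)) * Wᴴ) (X : Matrix n n ℂ)
    (s r : ℝ) :
    (matPow (matPow D s * (X * Xᴴ) * matPow D s) r).trace.re =
      (matPow ((Xᴴ * W) * diagonal (fun x => (supPow (d x) (2 * s) : ℂ)) * (Xᴴ * W)ᴴ) r).trace.re
        := by
  have hP : matPow D s = W * diagonal (fun x => (supPow (d x) s : ℂ)) * Wᴴ :=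
    matPow_eq_conj_diagonal hW hD s
  have hPh : (matPow D s)ᴴ = matPow D s := by
    rw [hP]; exact conj_diagonal_isHermitian W fun x => supPow (d x) s
  have hN : matPow D s * (X * Xᴴ) * matPow D s = (matPow D s * X) * (matPow D s * X)ᴴ := by
    rw [conjTranspose_mul, hPh]; simp only [Matrix.mul_assoc]
  have hsq : matPow D s * matPow D s =
      W * diagonal (fun x => (supPow (d x) (2 * s) : ℂ)) * Wᴴ := by
    rw [hP]
    calc _ = W * diagonal (fun x => (supPow (d x) s : ℂ)) * (Wᴴ * W) *
          diagonal (fun x => (supPow (d x) s : ℂ)) * Wᴴ := by simp only [Matrix.mul_assoc]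
      _ = _ := by
        rw [unitary_conjTranspose_mul hW, Matrix.mul_one, Matrix.mul_assoc W, diagonal_mul_diagonal]
        simp only [← Complex.ofReal_mul, supPow_mul_self (hd _)]
  have hY : (matPow D s * X)ᴴ * (matPow D s * X) =
      (Xᴴ * W) * diagonal (fun x => (supPow (d x) (2 * s) : ℂ)) * (Xᴴ * W)ᴴ := by
    calc _ = Xᴴ * (matPow D s * matPow D s) * X := by
          rw [conjTranspose_mul, hPh]; simp only [Matrix.mul_assoc]
      _ = _ := by
        rw [hsq, conjTranspose_mul, conjTranspose_conjTranspose]; simp only [Matrix.mul_assoc]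
  rw [hN, ← hY]
  exact trace_matPow_eq_of_charpoly_eq (isHermitian_mul_conjTranspose_self _)
    (isHermitian_conjTranspose_mul_self _) (charpoly_mul_comm _ _) r

theorem trace_mul_conj_diagonal (X W : Matrix n n ℂ) (d : n → ℝ) :
    ((X * Xᴴ) * (W * diagonal (fun x => (d x : ℂ)) * Wᴴ)).trace =
      ((Xᴴ * W) * diagonal (fun x => (d x : ℂ)) * (Xᴴ * W)ᴴ).trace := by
  rw [Matrix.mul_assoc X, Matrix.trace_mul_comm X, conjTranspose_mul, conjTranspose_conjTranspose]
  simp only [Matrix.mul_assoc]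

theorem dominates_conj_diagonal_iff {W : Matrix n n ℂ} (hW : W ∈ unitaryGroup n ℂ) (d : n → ℝ)
    (X : Matrix n n ℂ) :
    Dominates (W * diagonal (fun x => (d x : ℂ)) * Wᴴ) (X * Xᴴ) ↔
      ∀ x, d x = 0 → ∑ k, Complex.normSq ((Xᴴ * W) k x) = 0 := by
  have hWW := unitary_mul_conjTranspose hW
  have hWW' := unitary_conjTranspose_mul hW
  have hq : ∀ x, ∑ k, Complex.normSq ((Xᴴ * W) k x) = 0 ↔ ∀ k, (Xᴴ * W) k x = 0 := by
    intro x
    rw [Finset.sum_eq_zero_iff_of_nonneg fun k _ => Complex.normSq_nonneg _]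
    simp
  simp only [hq]
  refine ⟨fun h x hx k => ?_, fun h v hv => ?_⟩
  · have h1 := h (W *ᵥ Pi.single x 1) (by
      rw [mulVec_mulVec, Matrix.mul_assoc _ Wᴴ W, hWW', Matrix.mul_one, ← mulVec_mulVec,
        diagonal_mulVec_single, hx]
      simp)
    rw [self_mul_conjTranspose_mulVec_eq_zero, mulVec_mulVec] at h1
    simpa using congrFun h1 k
  · rw [self_mul_conjTranspose_mulVec_eq_zero]
    have h1 : diagonal (fun x => (d x : ℂ)) *ᵥ (Wᴴ *ᵥ v) = 0 := by
      have := congrArg (fun u => Wᴴ *ᵥ u) hv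
      simpa [mulVec_mulVec, ← Matrix.mul_assoc, hWW'] using this
    have h2 : Xᴴ *ᵥ v = (Xᴴ * W) *ᵥ (Wᴴ *ᵥ v) := by
      rw [mulVec_mulVec, Matrix.mul_assoc, hWW, Matrix.mul_one]
    rw [h2]
    ext k
    rw [mulVec, dotProduct]
    refine Finset.sum_eq_zero fun x _ => ?_
    have h3 := congrFun h1 x
    rw [mulVec_diagonal] at h3
    rcases mul_eq_zero.1 h3 with h0 | h0
    · rw [h x (by exact_mod_cast h0) k, zero_mul]
    · rw [h0, mul_zero]

end Sandwich

section Bipartite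

theorem margSnd_posSemidef {A B : Type*} [Fintype A] {ρ : Matrix (A × B) (A × B) ℂ}
    (hρ : ρ.PosSemidef) :
    (margSnd ρ).PosSemidef := by
  have : margSnd ρ = ∑ a, ρ.submatrix (fun b => (a, b)) (fun b => (a, b)) := by
    ext b b'
    simp [margSnd, Matrix.sum_apply]
  rw [this]
  exact posSemidef_sum _ fun a _ => hρ.submatrix _

theorem margFst_posSemidef {A B : Type*} [Fintype B] {ρ : Matrix (A × B) (A × B) ℂ}
    (hρ : ρ.PosSemidef) :
    (margFst ρ).PosSemidef := by
  have : margFst ρ = ∑ b, ρ.submatrix (fun a => (a, b)) (fun a => (a, b)) := by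
    ext a a'
    simp [margFst, Matrix.sum_apply]
  rw [this]
  exact posSemidef_sum _ fun b _ => hρ.submatrix _

theorem trace_margSnd {A B : Type*} [Fintype A] [Fintype B] (ρ : Matrix (A × B) (A × B) ℂ) :
    (margSnd ρ).trace = ρ.trace := by
  simp [Matrix.trace, margSnd, Fintype.sum_prod_type_right]

theorem sum_kronecker_conj_apply {A B : Type*} [Fintype A] [Fintype B] [DecidableEq A]
    {U : Matrix A A ℂ} (hU : U ∈ unitaryGroup A ℂ)
    (V : Matrix B B ℂ) (ρ : Matrix (A × B) (A × B) ℂ) (j : B) :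
    ∑ i, ((U ⊗ₖ V)ᴴ * ρ * (U ⊗ₖ V)) (i, j) (i, j) = (Vᴴ * margSnd ρ * V) j j := by
  have hδ : ∀ a a', ∑ i, star (U a i) * U a' i = if a' = a then 1 else 0 := by
    intro a a'
    have := congrFun (congrFun (unitary_mul_conjTranspose hU) a') a
    rw [Matrix.mul_apply, Matrix.one_apply] at this
    rw [← this]
    exact Finset.sum_congr rfl fun i _ => by rw [conjTranspose_apply, mul_comm]
  have hL : ∀ i, ((U ⊗ₖ V)ᴴ * ρ * (U ⊗ₖ V)) (i, j) (i, j) = ∑ b', ∑ b, ∑ a', ∑ a,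
      star (V b j) * ρ (a, b) (a', b') * V b' j * (star (U a i) * U a' i) := by
    intro i
    simp only [Matrix.mul_apply, Fintype.sum_prod_type_right, conjTranspose_apply,
      kroneckerMap_apply, Finset.sum_mul, star_mul']
    refine Finset.sum_congr rfl fun b' _ => ?_
    rw [Finset.sum_comm]
    refine Finset.sum_congr rfl fun b _ => Finset.sum_congr rfl fun a' _ =>
      Finset.sum_congr rfl fun a _ => ?_
    ring
  simp only [hL]
  rw [Finset.sum_comm, Matrix.mul_apply]
  refine Finset.sum_congr rfl fun b' _ => ?_
  rw [Finset.sum_comm, Matrix.mul_apply, Finset.sum_mul]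
  refine Finset.sum_congr rfl fun b _ => ?_
  rw [Finset.sum_comm]
  simp only [margSnd, of_apply, conjTranspose_apply, Finset.mul_sum, Finset.sum_mul]
  refine Finset.sum_congr rfl fun a' _ => ?_
  rw [Finset.sum_comm]
  simp only [← Finset.mul_sum, hδ]
  simp

theorem sum_normSq_purification {A B : Type*} [Fintype A] [Fintype B] [DecidableEq A]
    {U : Matrix A A ℂ} (hU : U ∈ unitaryGroup A ℂ)
    (V : Matrix B B ℂ) (X : Matrix (A × B) (A × B) ℂ) (j : B) :
    ∑ i, ∑ k, Complex.normSq ((Xᴴ * (U ⊗ₖ V)) k (i, j)) =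
      ((Vᴴ * margSnd (X * Xᴴ) * V) j j).re := by
  rw [← sum_kronecker_conj_apply hU, Complex.re_sum]
  refine Finset.sum_congr rfl fun i _ => ?_
  rw [← conjTranspose_mul_apply_self_re, conjTranspose_mul Xᴴ, conjTranspose_conjTranspose]
  simp only [Matrix.mul_assoc]

variable {A B : Type*} [Fintype A] [Fintype B] [DecidableEq A] [DecidableEq B]

theorem kronecker_conj_diagonal (U : Matrix A A ℂ) (V : Matrix B B ℂ) (t : A → ℝ) (s : B → ℝ) :
    (U * diagonal (fun i => (t i : ℂ)) * Uᴴ) ⊗ₖ (V * diagonal (fun j => (s j : ℂ)) * Vᴴ) =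
      (U ⊗ₖ V) * diagonal (fun x : A × B => ((t x.1 * s x.2 : ℝ) : ℂ)) * (U ⊗ₖ V)ᴴ := by
  rw [mul_kronecker_mul, mul_kronecker_mul, diagonal_kronecker_diagonal, conjTranspose_kronecker]
  simp only [Complex.ofReal_mul]

theorem kronecker_one_conj_diagonal (U : Matrix A A ℂ) {V : Matrix B B ℂ}
    (hV : V ∈ unitaryGroup B ℂ) (t : A → ℝ) :
    (U * diagonal (fun i => (t i : ℂ)) * Uᴴ) ⊗ₖ (1 : Matrix B B ℂ) =
      (U ⊗ₖ V) * diagonal (fun x : A × B => (t x.1 : ℂ)) * (U ⊗ₖ V)ᴴ := by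
  have h := kronecker_conj_diagonal U V t (fun _ => 1)
  simpa [unitary_mul_conjTranspose hV] using h

theorem conj_conj_diagonal {n : Type*} [Fintype n] [DecidableEq n] (E C : Matrix n n ℂ)
    (e : n → ℝ) :
    Eᴴ * (C * diagonal (fun x => (e x : ℂ)) * Cᴴ) * E =
      (Eᴴ * C) * diagonal (fun x => (e x : ℂ)) * (Eᴴ * C)ᴴ := by
  rw [conjTranspose_mul, conjTranspose_conjTranspose]
  simp only [Matrix.mul_assoc]

theorem sum_normSq_unitary_mul {n : Type*} [Fintype n] [DecidableEq n] {E : Matrix n n ℂ}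
    (hE : E ∈ unitaryGroup n ℂ) (C : Matrix n n ℂ) (x : n) :
    ∑ k, Complex.normSq ((Eᴴ * C) k x) = ∑ k, Complex.normSq (C k x) := by
  rw [← conjTranspose_mul_apply_self_re, ← conjTranspose_mul_apply_self_re, conjTranspose_mul,
    conjTranspose_conjTranspose, Matrix.mul_assoc, ← Matrix.mul_assoc E,
    unitary_mul_conjTranspose hE, Matrix.one_mul]

theorem sum_diag_rpow_le {C : Matrix (A × B) (A × B) ℂ} {E : Matrix (A × B) (A × B) ℂ}
    (hE : E ∈ unitaryGroup (A × B) ℂ) {t : A → ℝ} {s : B → ℝ} (ht : ∀ i, 0 ≤ t i)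
    (hs : ∀ j, 0 ≤ s j) {a b η : ℝ} (ha : 0 < a) (hb : 0 < b) (haη : 0 < a + η) :
    ∑ k, ((Eᴴ * (C * diagonal (fun x : A × B => (supPow (t x.1 * s x.2) (η / (a + b)) : ℂ)) * Cᴴ) * E)
        k k).re ^ ((a + b) / (a + b + η)) ≤
      (∑ j, supPow (s j) (η / b) * ∑ i, ∑ k, Complex.normSq (C k (i, j))) ^ (b / (a + b + η)) *
      (∑ k, ((Eᴴ * (C * diagonal (fun x : A × B => (supPow (t x.1) (η / a) : ℂ)) * Cᴴ) * E) k k).re ^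
        (a / (a + η))) ^ ((a + η) / (a + b + η)) := by
  have h := sum_rpow_sum_supPow_le (p := fun k x => Complex.normSq ((Eᴴ * C) k x)) ht hs
    (fun k x => Complex.normSq_nonneg _) ha hb haη
  simpa only [conj_conj_diagonal E C fun x : A × B => supPow (t x.1 * s x.2) (η / (a + b)),
    conj_conj_diagonal E C fun x : A × B => supPow (t x.1) (η / a),
    conj_diagonal_apply_self_re (Eᴴ * C), sum_normSq_unitary_mul hE] using h

theorem trace_matPow_conj_diagonal_le {C : Matrix (A × B) (A × B) ℂ} {t : A → ℝ} {s : B → ℝ}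
    (ht : ∀ i, 0 ≤ t i) (hs : ∀ j, 0 ≤ s j) {a b η : ℝ} (ha : 0 < a) (hb : 0 < b)
    (haη : 0 < a + η) (hη : η = 1 ∨ η = -1) :
    (matPow (C * diagonal (fun x : A × B => (supPow (t x.1 * s x.2) (η / (a + b)) : ℂ)) * Cᴴ)
        ((a + b) / (a + b + η))).trace.re ≤
      (∑ j, supPow (s j) (η / b) * ∑ i, ∑ k, Complex.normSq (C k (i, j))) ^ (b / (a + b + η)) *
      (matPow (C * diagonal (fun x : A × B => (supPow (t x.1) (η / a) : ℂ)) * Cᴴ)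
        (a / (a + η))).trace.re ^ ((a + η) / (a + b + η)) := by
  have hab : 0 < a + b := by positivity
  have hg : 0 < a + b + η := by linarith
  have hY : (C * diagonal (fun x : A × B => (supPow (t x.1 * s x.2) (η / (a + b)) : ℂ)) * Cᴴ).PosSemidef :=
    conj_diagonal_posSemidef C fun x => supPow_nonneg (mul_nonneg (ht _) (hs _)) _
  have hZ : (C * diagonal (fun x : A × B => (supPow (t x.1) (η / a) : ℂ)) * Cᴴ).PosSemidef :=
    conj_diagonal_posSemidef C fun x => supPow_nonneg (ht _) _
  have hS : 0 ≤ ∑ j, supPow (s j) (η / b) * ∑ i, ∑ k, Complex.normSq (C k (i, j)) :=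
    Finset.sum_nonneg fun j _ => mul_nonneg (supPow_nonneg (hs j) _)
      (Finset.sum_nonneg fun i _ => Finset.sum_nonneg fun k _ => Complex.normSq_nonneg _)
  rcases hη with rfl | rfl
  · rw [← sum_diag_eigenvectorUnitary hZ.1 (div_pos ha haη).ne']
    refine (trace_matPow_le_sum_diag_rpow hY hZ.1.eigenvectorUnitary.2 (div_pos hab hg) ?_).trans
      (sum_diag_rpow_le hZ.1.eigenvectorUnitary.2 ht hs ha hb haη)
    rw [div_le_one hg]
    linarith
  · rw [← sum_diag_eigenvectorUnitary hY.1 (div_pos hab hg).ne']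
    refine (sum_diag_rpow_le hY.1.eigenvectorUnitary.2 ht hs ha hb haη).trans ?_
    refine mul_le_mul_of_nonneg_left ?_ (Real.rpow_nonneg hS _)
    refine Real.rpow_le_rpow (Finset.sum_nonneg fun k _ => Real.rpow_nonneg ?_ _) ?_
      (div_pos haη hg).le
    · rw [conj_conj_diagonal _ C fun x : A × B => supPow (t x.1) (-1 / a),
        conj_diagonal_apply_self_re]
      exact Finset.sum_nonneg fun x _ => mul_nonneg (supPow_nonneg (ht _) _)
        (Complex.normSq_nonneg _)
    · refine sum_diag_rpow_le_trace_matPow hZ hY.1.eigenvectorUnitary.2 ?_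
      rw [le_div_iff₀ haη]
      linarith

end Bipartite

section Divergence

variable {n : Type*} [Fintype n] [DecidableEq n]

theorem renyiDiv_conj_diagonal {D W : Matrix n n ℂ} (hW : W ∈ unitaryGroup n ℂ) {d : n → ℝ}
    (hd : ∀ x, 0 ≤ d x) (hD : D = W * diagonal (fun x => (d x : ℂ)) * Wᴴ) (X : Matrix n n ℂ)
    {r : ℝ} (h : ∃ x, d x ≠ 0 ∧ ∑ k, Complex.normSq ((Xᴴ * W) k x) ≠ 0)
    (h' : (∀ x, d x = 0 → ∑ k, Complex.normSq ((Xᴴ * W) k x) = 0) ∨ r < 1) :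
    renyiDiv r (X * Xᴴ) D = (((r - 1)⁻¹ * Real.logb 2 (matPow ((Xᴴ * W) *
      diagonal (fun x => (supPow (d x) ((1 - r) / r) : ℂ)) * (Xᴴ * W)ᴴ) r).trace.re : ℝ) :
        EReal) := by
  rw [renyiDiv, if_pos, trace_matPow_sandwich hW hd hD, ← mul_div_assoc,
    mul_div_mul_left _ _ two_ne_zero]
  rw [hD, trace_mul_conj_diagonal, trace_conj_diagonal_ne_zero_iff _ hd,
    dominates_conj_diagonal_iff hW]
  exact ⟨h, h'⟩

theorem renyiDiv_conj_diagonal_eq_top {D W : Matrix n n ℂ} (hW : W ∈ unitaryGroup n ℂ) {d : n → ℝ}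
    (hd : ∀ x, 0 ≤ d x) (hD : D = W * diagonal (fun x => (d x : ℂ)) * Wᴴ) (X : Matrix n n ℂ)
    {r : ℝ} (h : ¬ ((∃ x, d x ≠ 0 ∧ ∑ k, Complex.normSq ((Xᴴ * W) k x) ≠ 0) ∧
      ((∀ x, d x = 0 → ∑ k, Complex.normSq ((Xᴴ * W) k x) = 0) ∨ r < 1))) :
    renyiDiv r (X * Xᴴ) D = ⊤ := by
  rw [renyiDiv, if_neg]
  rwa [hD, trace_mul_conj_diagonal, trace_conj_diagonal_ne_zero_iff _ hd,
    dominates_conj_diagonal_iff hW]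

theorem logb_le_of_le_rpow_mul_rpow {Q S R P a b g η : ℝ} (hQ : 0 < Q) (hS : 0 ≤ S) (hR : 0 ≤ R)
    (hP : 0 ≤ P) (hb : 0 < b) (hbη : 0 < b - η) (haη : 0 < a + η) (hg : 0 < g + η)
    (h : Q ≤ S ^ (b / (g + η)) * P ^ ((a + η) / (g + η))) (hSR : S ≤ R ^ ((b - η) / b)) :
    (g + η) * Real.logb 2 Q ≤ (b - η) * Real.logb 2 R + (a + η) * Real.logb 2 P := by
  have hS0 : S ≠ 0 := by
    rintro rfl
    rw [Real.zero_rpow (div_pos hb hg).ne', zero_mul] at h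
    linarith
  have hP0 : P ≠ 0 := by
    rintro rfl
    rw [Real.zero_rpow (div_pos haη hg).ne', mul_zero] at h
    linarith
  have hS' : 0 < S := lt_of_le_of_ne hS hS0.symm
  have hP' : 0 < P := lt_of_le_of_ne hP hP0.symm
  have hR0 : R ≠ 0 := by
    rintro rfl
    rw [Real.zero_rpow (div_pos hbη hb).ne'] at hSR
    linarith
  have hR' : 0 < R := lt_of_le_of_ne hR hR0.symm
  have h1 := Real.logb_le_logb_of_le one_lt_two hQ h
  rw [Real.logb_mul (Real.rpow_pos_of_pos hS' _).ne' (Real.rpow_pos_of_pos hP' _).ne',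
    Real.logb_rpow_eq_mul_logb_of_pos hS', Real.logb_rpow_eq_mul_logb_of_pos hP'] at h1
  have h2 := Real.logb_le_logb_of_le one_lt_two hS' hSR
  rw [Real.logb_rpow_eq_mul_logb_of_pos hR'] at h2
  have h3 := mul_le_mul_of_nonneg_left h1 hg.le
  have h4 := mul_le_mul_of_nonneg_left h2 hb.le
  have e1 : (g + η) * (b / (g + η) * Real.logb 2 S + (a + η) / (g + η) * Real.logb 2 P) =
      b * Real.logb 2 S + (a + η) * Real.logb 2 P := by field_simp
  have e2 : b * ((b - η) / b * Real.logb 2 R) = (b - η) * Real.logb 2 R := by field_simp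
  linarith

theorem trace_matPow_nonneg {M : Matrix n n ℂ} (hM : M.PosSemidef) (r : ℝ) :
    0 ≤ (matPow M r).trace.re := by
  rw [trace_matPow hM.1]
  exact Finset.sum_nonneg fun i _ => supPow_nonneg (hM.eigenvalues_nonneg i) r

end Divergence

section Decomposition

variable {A B : Type*} [Fintype A] [Fintype B] [DecidableEq A] [DecidableEq B]

/-- The decomposition inequality in terms of the traces defining the Rényi quantities. -/
theorem logb_trace_matPow_le {C : Matrix (A × B) (A × B) ℂ} {t : A → ℝ} {s : B → ℝ}
    (ht : ∀ i, 0 ≤ t i) (hs : ∀ j, 0 ≤ s j) {a b η : ℝ} (ha : 0 < a) (hb : 0 < b)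
    (haη : 0 < a + η) (hbη : 0 < b - η) (hη : η = 1 ∨ η = -1) {R : ℝ} (hR : 0 ≤ R)
    (hSR : ∑ j, supPow (s j) (η / b) * ∑ i, ∑ k, Complex.normSq (C k (i, j)) ≤ R ^ ((b - η) / b))
    (hne : ∃ x : A × B, t x.1 * s x.2 ≠ 0 ∧ ∑ k, Complex.normSq (C k x) ≠ 0) :
    (a + b + η) * Real.logb 2
        (matPow (C * diagonal (fun x : A × B => (supPow (t x.1 * s x.2) (η / (a + b)) : ℂ)) * Cᴴ)
          ((a + b) / (a + b + η))).trace.re ≤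
      (b - η) * Real.logb 2 R + (a + η) * Real.logb 2
        (matPow (C * diagonal (fun x : A × B => (supPow (t x.1) (η / a) : ℂ)) * Cᴴ)
          (a / (a + η))).trace.re := by
  have hts : ∀ x : A × B, 0 ≤ t x.1 * s x.2 := fun x => mul_nonneg (ht _) (hs _)
  refine logb_le_of_le_rpow_mul_rpow (trace_matPow_pos (conj_diagonal_posSemidef C
      fun x : A × B => supPow_nonneg (hts x) _) ?_ _)
    (Finset.sum_nonneg fun j _ => mul_nonneg (supPow_nonneg (hs j) _)
      (Finset.sum_nonneg fun i _ => Finset.sum_nonneg fun k _ => Complex.normSq_nonneg _)) hR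
    (trace_matPow_nonneg (conj_diagonal_posSemidef C fun x : A × B => supPow_nonneg (ht x.1) _) _)
    hb hbη haη (by linarith) (trace_matPow_conj_diagonal_le ht hs ha hb haη hη) hSR
  rw [trace_conj_diagonal_ne_zero_iff C fun x : A × B => supPow_nonneg (hts x) _]
  obtain ⟨x, hx, hx'⟩ := hne
  exact ⟨x, (supPow_ne_zero_iff (hts x) _).2 hx, hx'⟩

open scoped MatrixOrder Matrix.Norms.L2Operator in
theorem Matrix.PosSemidef.exists_eq_mul_conjTranspose {n : Type*} [Fintype n] [DecidableEq n]
    {ρ : Matrix n n ℂ} (hρ : ρ.PosSemidef) : ∃ X : Matrix n n ℂ, ρ = X * Xᴴ := by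
  obtain ⟨Y, hY⟩ := CStarAlgebra.nonneg_iff_eq_star_mul_self.1 hρ.nonneg
  exact ⟨Yᴴ, by rw [conjTranspose_conjTranspose, hY]; rfl⟩

theorem renyiEntropy_add_renyiDiv_le {ρ : Matrix (A × B) (A × B) ℂ} (hρ : ρ.PosSemidef)
    {α β γ : ℝ} (hα : 0 < α) (hα1 : α < 1) (hγ : 0 < γ) (hγ1 : γ < 1) (hβ : 1 < β)
    (hrel : α / (α - 1) = β / (β - 1) + γ / (γ - 1)) {τ : Matrix A A ℂ} (hτ : τ.PosSemidef)
    {σ : Matrix B B ℂ} (hσ : IsDensity σ) :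
    (renyiEntropy β (margSnd ρ) : EReal) + renyiDiv α ρ (τ ⊗ₖ (1 : Matrix B B ℂ)) ≤
      renyiDiv γ ρ (τ ⊗ₖ σ) := by
  have hM := margSnd_posSemidef hρ
  obtain ⟨X, rfl⟩ := hρ.exists_eq_mul_conjTranspose
  obtain ⟨hσ, hσ1⟩ := hσ
  have hU := hτ.1.eigenvectorUnitary.2
  have hV := hσ.1.eigenvectorUnitary.2
  have hτd := hτ.1.eq_conj_diagonal
  have hσd := hσ.1.eq_conj_diagonal
  have ht := hτ.eigenvalues_nonneg
  have hs := hσ.eigenvalues_nonneg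
  have hs1 : ∑ j, hσ.1.eigenvalues j = 1 := by
    rw [hσ.1.trace_eq_sum_eigenvalues] at hσ1
    simpa using congrArg Complex.re hσ1
  generalize hσ.1.eigenvalues = s at *
  generalize hτ.1.eigenvalues = t at *
  generalize (hσ.1.eigenvectorUnitary : Matrix B B ℂ) = V at *
  generalize (hτ.1.eigenvectorUnitary : Matrix A A ℂ) = U at *
  have hW : U ⊗ₖ V ∈ unitaryGroup (A × B) ℂ := kronecker_mem_unitary hU hV
  have hD := kronecker_conj_diagonal U V t s
  rw [← hτd, ← hσd] at hD
  have hD1 := kronecker_one_conj_diagonal U hV t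
  rw [← hτd] at hD1
  have hts : ∀ x : A × B, 0 ≤ t x.1 * s x.2 := fun x => mul_nonneg (ht _) (hs _)
  by_cases hne : ∃ x : A × B, t x.1 * s x.2 ≠ 0 ∧
      ∑ k, Complex.normSq ((Xᴴ * (U ⊗ₖ V)) k x) ≠ 0
  swap
  · rw [renyiDiv_conj_diagonal_eq_top hW hts hD X fun h => hne h.1]
    exact le_top
  have hne1 : ∃ x : A × B, t x.1 ≠ 0 ∧ ∑ k, Complex.normSq ((Xᴴ * (U ⊗ₖ V)) k x) ≠ 0 := by
    obtain ⟨x, hx, hx'⟩ := hne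
    exact ⟨x, left_ne_zero_of_mul hx, hx'⟩
  rw [renyiDiv_conj_diagonal hW hts hD X hne (Or.inr hγ1),
    renyiDiv_conj_diagonal hW (fun x => ht x.1) hD1 X hne1 (Or.inr hα1), ← EReal.coe_add,
    EReal.coe_le_coe_iff, renyiEntropy]
  have hα' : 0 < 1 - α := by linarith
  have hγ' : 0 < 1 - γ := by linarith
  have hβ' : 0 < β - 1 := by linarith
  have hα'' : α - 1 ≠ 0 := by linarith
  have hγ'' : γ - 1 ≠ 0 := by linarith
  have ha : 0 < α / (1 - α) := div_pos hα hα'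
  have hb : 0 < β / (β - 1) := div_pos (by linarith) hβ'
  have hg : α / (1 - α) + β / (β - 1) = γ / (1 - γ) := by
    rw [← neg_sub α, ← neg_sub γ, div_neg, div_neg, hrel]; ring
  have eb : β / (β - 1) - 1 = (β - 1)⁻¹ := by field_simp; ring
  have ea : α / (1 - α) + 1 = (1 - α)⁻¹ := by field_simp; ring
  have eg : γ / (1 - γ) + 1 = (1 - γ)⁻¹ := by field_simp; ring
  have hr : ∀ j, 0 ≤ ∑ i, ∑ k, Complex.normSq ((Xᴴ * (U ⊗ₖ V)) k (i, j)) := fun j =>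
    Finset.sum_nonneg fun i _ => Finset.sum_nonneg fun k _ => Complex.normSq_nonneg _
  have key := logb_trace_matPow_le (C := Xᴴ * (U ⊗ₖ V)) ht hs ha hb (by positivity)
    (by rw [eb]; positivity) (Or.inl rfl) (trace_matPow_nonneg hM β) ?_ hne
  · rw [hg, eb, ea, eg] at key
    have e1 : 1 / (γ / (1 - γ)) = (1 - γ) / γ := one_div_div _ _
    have e2 : γ / (1 - γ) / (1 - γ)⁻¹ = γ := by field_simp
    have e3 : 1 / (α / (1 - α)) = (1 - α) / α := one_div_div _ _
    have e4 : α / (1 - α) / (1 - α)⁻¹ = α := by field_simp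
    rw [e1, e2, e3, e4] at key
    rw [← neg_sub β, ← neg_sub 1 α, ← neg_sub 1 γ, inv_neg, inv_neg, inv_neg]
    linarith
  · have hR : ∑ j, (∑ i, ∑ k, Complex.normSq ((Xᴴ * (U ⊗ₖ V)) k (i, j))) ^ β ≤
        (matPow (margSnd (X * Xᴴ)) β).trace.re := by
      simp only [sum_normSq_purification hU]
      exact sum_diag_rpow_le_trace_matPow hM hV hβ.le
    have e5 : (β / (β - 1) - 1) / (β / (β - 1)) = β⁻¹ := by rw [eb]; field_simp
    have e6 : 1 / (β / (β - 1)) = 1 - β⁻¹ := by field_simp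
    have hβi : β⁻¹ < 1 := inv_lt_one_of_one_lt₀ hβ
    rw [e5, e6]
    refine le_trans ?_ (Real.rpow_le_rpow (Finset.sum_nonneg fun j _ => Real.rpow_nonneg (hr j) β)
      hR (by positivity))
    have h := sum_rpow_mul_rpow_le Finset.univ hs (fun j => Real.rpow_nonneg (hr j) β)
      (show 0 < 1 - β⁻¹ by linarith) (show 0 < β⁻¹ by positivity) (by ring)
    rw [hs1, Real.one_rpow, one_mul] at h
    refine le_trans (le_of_eq (Finset.sum_congr rfl fun j _ => ?_)) h
    rw [supPow_eq_rpow _ (by linarith), Real.rpow_rpow_inv (hr j) (by linarith)]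

theorem exists_renyiDiv_le_renyiEntropy_add {ρ : Matrix (A × B) (A × B) ℂ} (hρ : IsDensity ρ)
    {α β γ : ℝ} (hβ : 0 < β) (hβ1 : β < 1) (hγ : 1 < γ) (hα : 1 < α)
    (hrel : α / (α - 1) = β / (β - 1) + γ / (γ - 1)) {τ : Matrix A A ℂ} (hτ : τ.PosSemidef) :
    ∃ σ : Matrix B B ℂ, IsDensity σ ∧ renyiDiv γ ρ (τ ⊗ₖ σ) ≤
      (renyiEntropy β (margSnd ρ) : EReal) + renyiDiv α ρ (τ ⊗ₖ (1 : Matrix B B ℂ)) := by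
  obtain ⟨hρ, hρ1⟩ := hρ
  have hM := margSnd_posSemidef hρ
  have hMtr : (margSnd ρ).trace ≠ 0 := by rw [trace_margSnd, hρ1]; exact one_ne_zero
  have hR0 := trace_matPow_pos hM hMtr β
  obtain ⟨X, rfl⟩ := hρ.exists_eq_mul_conjTranspose
  have hU := hτ.1.eigenvectorUnitary.2
  have hV := hM.1.eigenvectorUnitary.2
  have hτd := hτ.1.eq_conj_diagonal
  have ht := hτ.eigenvalues_nonneg
  have hr := hM.eigenvalues_nonneg
  have hRr := trace_matPow hM.1 β
  have hMd := hM.1.eq_conj_diagonal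
  generalize hτ.1.eigenvalues = t at *
  generalize hM.1.eigenvalues = r at *
  generalize (hM.1.eigenvectorUnitary : Matrix B B ℂ) = V at *
  generalize (hτ.1.eigenvectorUnitary : Matrix A A ℂ) = U at *
  have hrj : ∀ j, ∑ i, ∑ k, Complex.normSq ((Xᴴ * (U ⊗ₖ V)) k (i, j)) = r j := by
    intro j
    have e : Vᴴ * margSnd (X * Xᴴ) * V = diagonal (fun i => (r i : ℂ)) := by
      rw [hMd]
      calc _ = (Vᴴ * V) * diagonal (fun i => (r i : ℂ)) * (Vᴴ * V) := by
            simp only [Matrix.mul_assoc]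
        _ = _ := by rw [unitary_conjTranspose_mul hV, Matrix.one_mul, Matrix.mul_one]
    rw [sum_normSq_purification hU, e]
    simp
  set R : ℝ := (matPow (margSnd (X * Xᴴ)) β).trace.re
  set s : B → ℝ := fun j => supPow (r j) β / R with hs_def
  have hs : ∀ j, 0 ≤ s j := fun j => div_nonneg (supPow_nonneg (hr j) β) hR0.le
  have hs0 : ∀ j, s j = 0 → r j = 0 := by
    intro j h
    by_contra h0
    exact (div_pos (supPow_pos (lt_of_le_of_ne (hr j) (Ne.symm h0)) β) hR0).ne' h
  have hs1 : ∑ j, s j = 1 := by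
    rw [← Finset.sum_div, ← hRr, div_self hR0.ne']
  refine ⟨V * diagonal (fun j => (s j : ℂ)) * Vᴴ, ⟨conj_diagonal_posSemidef V hs, ?_⟩, ?_⟩
  · rw [Matrix.trace_mul_comm, ← Matrix.mul_assoc, unitary_conjTranspose_mul hV, Matrix.one_mul,
      trace_diagonal]
    exact_mod_cast hs1
  have hW : U ⊗ₖ V ∈ unitaryGroup (A × B) ℂ := kronecker_mem_unitary hU hV
  have hD := kronecker_conj_diagonal U V t s
  rw [← hτd] at hD
  have hD1 := kronecker_one_conj_diagonal U hV t
  rw [← hτd] at hD1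
  have hts : ∀ x : A × B, 0 ≤ t x.1 * s x.2 := fun x => mul_nonneg (ht _) (hs _)
  have hq : ∀ x, 0 ≤ ∑ k, Complex.normSq ((Xᴴ * (U ⊗ₖ V)) k x) := fun x =>
    Finset.sum_nonneg fun k _ => Complex.normSq_nonneg _
  by_cases hdom : (∃ x : A × B, t x.1 ≠ 0 ∧ ∑ k, Complex.normSq ((Xᴴ * (U ⊗ₖ V)) k x) ≠ 0) ∧
      ((∀ x : A × B, t x.1 = 0 → ∑ k, Complex.normSq ((Xᴴ * (U ⊗ₖ V)) k x) = 0) ∨ α < 1)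
  swap
  · rw [renyiDiv_conj_diagonal_eq_top hW (fun x => ht x.1) hD1 X hdom, EReal.coe_add_top]
    exact le_top
  have hsq : ∀ x : A × B, s x.2 = 0 → ∑ k, Complex.normSq ((Xᴴ * (U ⊗ₖ V)) k x) = 0 := by
    rintro ⟨i, j⟩ h
    have h0 := (hrj j).trans (hs0 j h)
    exact (Finset.sum_eq_zero_iff_of_nonneg fun i _ => hq (i, j)).1 h0 i (Finset.mem_univ i)
  have hne : ∃ x : A × B, t x.1 * s x.2 ≠ 0 ∧
      ∑ k, Complex.normSq ((Xᴴ * (U ⊗ₖ V)) k x) ≠ 0 := by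
    obtain ⟨x, hx, hx'⟩ := hdom.1
    exact ⟨x, mul_ne_zero hx fun h => hx' (hsq x h), hx'⟩
  have hdom' : ∀ x : A × B, t x.1 * s x.2 = 0 →
      ∑ k, Complex.normSq ((Xᴴ * (U ⊗ₖ V)) k x) = 0 := by
    intro x hx
    rcases mul_eq_zero.1 hx with h | h
    · exact hdom.2.resolve_right (by linarith) x h
    · exact hsq x h
  rw [renyiDiv_conj_diagonal hW hts hD X hne (Or.inl hdom'),
    renyiDiv_conj_diagonal hW (fun x => ht x.1) hD1 X hdom.1 hdom.2, ← EReal.coe_add,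
    EReal.coe_le_coe_iff, renyiEntropy]
  have hα' : 0 < α - 1 := by linarith
  have hγ' : 0 < γ - 1 := by linarith
  have hβ' : 0 < 1 - β := by linarith
  have ha : 0 < α / (α - 1) := div_pos (by linarith) hα'
  have hb : 0 < β / (1 - β) := div_pos hβ hβ'
  have hg : α / (α - 1) + β / (1 - β) = γ / (γ - 1) := by
    rw [hrel, ← neg_sub β, div_neg]; ring
  have eb : β / (1 - β) - -1 = (1 - β)⁻¹ := by field_simp; ring
  have ea : α / (α - 1) + -1 = (α - 1)⁻¹ := by field_simp; ring
  have eg : γ / (γ - 1) + -1 = (γ - 1)⁻¹ := by field_simp; ring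
  have key := logb_trace_matPow_le (C := Xᴴ * (U ⊗ₖ V)) ht hs ha hb
    (by rw [ea]; positivity) (by rw [eb]; positivity) (Or.inr rfl) hR0.le ?_ hne
  · rw [hg, eb, ea, eg] at key
    have e1 : -1 / (γ / (γ - 1)) = (1 - γ) / γ := by field_simp; ring
    have e2 : γ / (γ - 1) / (γ - 1)⁻¹ = γ := by field_simp
    have e3 : -1 / (α / (α - 1)) = (1 - α) / α := by field_simp; ring
    have e4 : α / (α - 1) / (α - 1)⁻¹ = α := by field_simp
    rwa [e1, e2, e3, e4] at key
  · have e5 : (β / (1 - β) - -1) / (β / (1 - β)) = β⁻¹ := by rw [eb]; field_simp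
    have e6 : -1 / (β / (1 - β)) = 1 - β⁻¹ := by field_simp; ring
    have hsum : ∀ j, supPow (s j) (1 - β⁻¹) * r j = supPow (r j) β * R ^ (β⁻¹ - 1) := by
      intro j
      by_cases h : r j = 0
      · simp [h, supPow]
      have hrpos : 0 < r j := lt_of_le_of_ne (hr j) (Ne.symm h)
      have hsj : s j ≠ 0 := fun h0 => h (hs0 j h0)
      rw [supPow, if_neg hsj]
      simp only [hs_def, supPow, if_neg h]
      rw [Real.div_rpow (Real.rpow_nonneg (hr j) _) hR0.le, ← Real.rpow_mul (hr j),
        ← neg_sub β⁻¹ 1, Real.rpow_neg hR0.le, div_inv_eq_mul, mul_right_comm]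
      congr 1
      nth_rewrite 2 [← Real.rpow_one (r j)]
      rw [← Real.rpow_add hrpos]
      congr 1
      field_simp
      ring
    simp only [hrj, e5, e6, hsum]
    rw [← Finset.sum_mul, ← hRr]
    nth_rewrite 1 [← Real.rpow_one R]
    rw [← Real.rpow_add hR0]
    simp

end Decomposition

/-- **Proposition 2:** for `1/α' = 1/β' + 1/γ'`: if `α ∈ (0,1)`, `γ ∈ [1/2,1)`, `β ∈ (1,∞)`
then the decomposition rules hold with `≥`; if `β ∈ [1/2,1)`, `γ ∈ (1,2)`, `α ∈ (1,∞)` they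
hold with `≤`. -/
theorem renyi_decomposition_prop2
    {A B : Type*} [Fintype A] [Fintype B] [DecidableEq A] [DecidableEq B]
    (ρ : Matrix (A × B) (A × B) ℂ) (hρ : IsDensity ρ)
    {α β γ : ℝ} (hα1 : α ≠ 1) (hβ1 : β ≠ 1) (hγ1 : γ ≠ 1)
    (hrel : α / (α - 1) = β / (β - 1) + γ / (γ - 1)) :
    ((0 < α ∧ α < 1) → (1 / 2 ≤ γ ∧ γ < 1) → (1 < β) →
      (mutInfUp γ ρ ≥ (renyiEntropy β (margSnd ρ) : EReal) - condEntDown α ρ ∧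
        mutInfDown γ ρ ≥ (renyiEntropy β (margSnd ρ) : EReal) - condEntUp α ρ)) ∧
    ((1 / 2 ≤ β ∧ β < 1) → (1 < γ ∧ γ < 2) → (1 < α) →
      (mutInfUp γ ρ ≤ (renyiEntropy β (margSnd ρ) : EReal) - condEntDown α ρ ∧
        mutInfDown γ ρ ≤ (renyiEntropy β (margSnd ρ) : EReal) - condEntUp α ρ)) := by
  refine ⟨fun hα hγ hβ => ?_, fun hβ hγ hα => ?_⟩
  · have hle := fun {τ : Matrix A A ℂ} (hτ : τ.PosSemidef) {σ : Matrix B B ℂ} (hσ : IsDensity σ) =>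
      renyiEntropy_add_renyiDiv_le hρ.1 hα.1 hα.2 (by linarith [hγ.1]) hγ.2 hβ hrel hτ hσ
    refine ⟨le_iInf fun σ => ?_, le_iInf fun τ => le_iInf fun σ => ?_⟩
    · rw [condEntDown, sub_eq_add_neg, neg_neg]
      exact hle (margFst_posSemidef hρ.1) σ.2
    · refine (EReal.sub_le_sub le_rfl (le_iSup (fun τ : {τ : Matrix A A ℂ // IsDensity τ} =>
        -renyiDiv α ρ ((τ : Matrix A A ℂ) ⊗ₖ (1 : Matrix B B ℂ))) τ)).trans ?_
      rw [sub_eq_add_neg, neg_neg]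
      exact hle τ.2.1 σ.2
  · have hex := fun {τ : Matrix A A ℂ} (hτ : τ.PosSemidef) =>
      exists_renyiDiv_le_renyiEntropy_add hρ (by linarith [hβ.1]) hβ.2 hγ.1 hα hrel hτ
    constructor
    · obtain ⟨σ, hσ, h⟩ := hex (margFst_posSemidef hρ.1)
      rw [condEntDown, sub_eq_add_neg, neg_neg]
      exact (iInf_le _ (⟨σ, hσ⟩ : {σ : Matrix B B ℂ // IsDensity σ})).trans h
    · rw [EReal.le_sub_iff_add_le (Or.inr (EReal.coe_ne_bot _)) (Or.inr (EReal.coe_ne_top _)),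
        add_comm, ← EReal.le_sub_iff_add_le (Or.inr (EReal.coe_ne_bot _))
          (Or.inr (EReal.coe_ne_top _))]
      refine iSup_le fun τ => ?_
      rw [EReal.le_sub_iff_add_le (Or.inr (EReal.coe_ne_bot _)) (Or.inr (EReal.coe_ne_top _)),
        add_comm, ← EReal.le_sub_iff_add_le (Or.inr (EReal.coe_ne_bot _))
          (Or.inr (EReal.coe_ne_top _)), sub_eq_add_neg, neg_neg]
      obtain ⟨σ, hσ, h⟩ := hex τ.2.1
      exact ((iInf_le _ τ).trans
        (iInf_le _ (⟨σ, hσ⟩ : {σ : Matrix B B ℂ // IsDensity σ}))).trans h
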